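/- Let X : [0,∞) → ℝ³ be a continuous path, let v ∈ ℝ³ with v ≠ 0, and let C > 0 satisfy ‖X(t) − t·v‖ ≤ C(1 + √t) for all t ≥ 0. Let Σ be an open subset of the unit sphere S² ⊂ ℝ³ such that v/‖v‖ does not lie in the topological boundary of Σ (relative to S²). Then there exists R₀ > 0 such that for every R ≥ R₀ the first exit time τ_R(X) is finite, and X(τ_R(X)) ∈ R·Σ if and only if v/‖v‖ ∈ Σ. -/

import Mathlib

open Filter Topology

section FirstExit

variable {E : Type*} [NormedAddCommGroup E]

theorem isLeast_firstExit {X : ℝ → E} (hX : ContinuousOn X (Set.Ici 0)) {R : ℝ}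
    (hne : {t : ℝ | 0 ≤ t ∧ R ≤ ‖X t‖}.Nonempty) :
    IsLeast {t : ℝ | 0 ≤ t ∧ R ≤ ‖X t‖} (sInf {t : ℝ | 0 ≤ t ∧ R ≤ ‖X t‖}) := by
  have hbdd : BddBelow {t : ℝ | 0 ≤ t ∧ R ≤ ‖X t‖} := ⟨0, fun t ht => ht.1⟩
  have hclosed : IsClosed {t : ℝ | 0 ≤ t ∧ R ≤ ‖X t‖} :=
    hX.norm.preimage_isClosed_of_isClosed isClosed_Ici isClosed_Ici
  exact ⟨hclosed.csInf_mem hne hbdd, fun t ht => csInf_le hbdd ht⟩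

theorem norm_eq_of_isLeast_exit {X : ℝ → E} (hX : ContinuousOn X (Set.Ici 0)) {R T : ℝ}
    (hR : ‖X 0‖ ≤ R) (hT : IsLeast {t : ℝ | 0 ≤ t ∧ R ≤ ‖X t‖} T) : ‖X T‖ = R := by
  obtain ⟨s, hs, hsR⟩ := intermediate_value_Icc hT.1.1
    (hX.norm.mono Set.Icc_subset_Ici_self) ⟨hR, hT.1.2⟩
  have hTs : T = s := le_antisymm (hT.2 ⟨hs.1, hsR.ge⟩) hs.2
  rw [hTs]
  exact hsR

variable [NormedSpace ℝ E]

theorem tendsto_inv_smul_of_norm_sub_le_sqrt {X : ℝ → E} {v : E} {C : ℝ}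
    (hbound : ∀ t : ℝ, 0 ≤ t → ‖X t - t • v‖ ≤ C * (1 + √t)) :
    Tendsto (fun t : ℝ => t⁻¹ • X t) atTop (𝓝 v) := by
  rw [tendsto_iff_norm_sub_tendsto_zero]
  have hlim : Tendsto (fun t : ℝ => C * (t⁻¹ + (√t)⁻¹)) atTop (𝓝 0) := by
    simpa using (tendsto_inv_atTop_zero.add
      (tendsto_inv_atTop_zero.comp Real.tendsto_sqrt_atTop)).const_mul C
  refine squeeze_zero' (Eventually.of_forall fun t => norm_nonneg _) ?_ hlim
  filter_upwards [eventually_gt_atTop 0] with t ht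
  have hs : t⁻¹ * √t = (√t)⁻¹ := by
    rw [inv_mul_eq_div, Real.sqrt_div_self]
  calc ‖t⁻¹ • X t - v‖ = ‖t⁻¹ • (X t - t • v)‖ := by
        rw [smul_sub, inv_smul_smul₀ ht.ne']
    _ = t⁻¹ * ‖X t - t • v‖ := by
        rw [norm_smul, Real.norm_of_nonneg (inv_nonneg.2 ht.le)]
    _ ≤ t⁻¹ * (C * (1 + √t)) := by
        gcongr
        exact hbound t ht.le
    _ = C * (t⁻¹ + (√t)⁻¹) := by
        rw [← hs]
        ring

theorem tendsto_norm_atTop_of_tendsto_inv_smul {X : ℝ → E} {v : E} (hv : v ≠ 0)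
    (h : Tendsto (fun t : ℝ => t⁻¹ • X t) atTop (𝓝 v)) :
    Tendsto (fun t => ‖X t‖) atTop atTop := by
  refine (tendsto_id.atTop_mul_pos (norm_pos_iff.2 hv) h.norm).congr' ?_
  filter_upwards [eventually_gt_atTop 0] with t ht
  rw [norm_smul, norm_inv, Real.norm_of_nonneg ht.le, id, mul_inv_cancel_left₀ ht.ne']

theorem tendsto_normalize_of_tendsto_inv_smul {X : ℝ → E} {v : E} (hv : v ≠ 0)
    (h : Tendsto (fun t : ℝ => t⁻¹ • X t) atTop (𝓝 v)) :
    Tendsto (fun t => ‖X t‖⁻¹ • X t) atTop (𝓝 (‖v‖⁻¹ • v)) := by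
  refine ((h.norm.inv₀ (norm_ne_zero_iff.2 hv)).smul h).congr' ?_
  filter_upwards [eventually_gt_atTop 0] with t ht
  rw [norm_smul, norm_inv, Real.norm_of_nonneg ht.le, smul_smul]
  congr 1
  field_simp

end FirstExit

/-- Near a point outside the relative boundary, membership in a subset is locally constant. -/
theorem eventually_mem_iff_of_notMem_relative_frontier {α : Type*} [TopologicalSpace α]
    {S K : Set α} {u : α} (huK : u ∈ K) (hu : u ∉ closure S ∩ closure (K \ S)) :
    ∀ᶠ x in 𝓝 u, x ∈ K → (x ∈ S ↔ u ∈ S) := by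
  by_cases huS : u ∈ S
  · have h : u ∉ closure (K \ S) := fun h => hu ⟨subset_closure huS, h⟩
    filter_upwards [isClosed_closure.isOpen_compl.mem_nhds h] with x hx hxK
    have : x ∈ S := by
      by_contra hxS
      exact hx (subset_closure ⟨hxK, hxS⟩)
    tauto
  · have h : u ∉ closure S := fun h => hu ⟨h, subset_closure ⟨huK, huS⟩⟩
    filter_upwards [isClosed_closure.isOpen_compl.mem_nhds h] with x hx hxK
    have : x ∉ S := fun hxS => hx (subset_closure hxS)
    tauto

/- STATEMENT 1: A continuous, asymptotically straight path with nonzero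
asymptotic velocity `v` eventually (for all large `R`) exits the ball of radius
`R` at a finite first exit time, and the exit point lies in the cap
`R • S = {R • ω : ω ∈ S}` if and only if `v/‖v‖ ∈ S`, provided `S` is an open
subset of the unit sphere and `v/‖v‖` does not lie in the topological boundary
of `S` relative to the sphere.  For a set `S` contained in the (closed) unit
sphere, the boundary of `S` relative to the sphere is
`closure S ∩ closure (sphere \ S)` (closures taken in the ambient space).
The first exit time is `sInf {t | 0 ≤ t ∧ R ≤ ‖X t‖}`; its finiteness is
expressed by the nonemptiness of this set. -/
theorem first_exit_in_cap_iff_velocity_in_cone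
    (X : ℝ → EuclideanSpace ℝ (Fin 3))
    (hXcont : ContinuousOn X (Set.Ici (0 : ℝ)))
    (v : EuclideanSpace ℝ (Fin 3)) (hv : v ≠ 0)
    (C : ℝ) (hC : 0 < C)
    (hbound : ∀ t : ℝ, 0 ≤ t → ‖X t - t • v‖ ≤ C * (1 + Real.sqrt t))
    (S : Set (EuclideanSpace ℝ (Fin 3)))
    (hSsub : S ⊆ Metric.sphere (0 : EuclideanSpace ℝ (Fin 3)) 1)
    (hSopen : ∃ U : Set (EuclideanSpace ℝ (Fin 3)),
      IsOpen U ∧ S = U ∩ Metric.sphere (0 : EuclideanSpace ℝ (Fin 3)) 1)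
    (hvfr : ‖v‖⁻¹ • v ∉
      closure S ∩ closure ((Metric.sphere (0 : EuclideanSpace ℝ (Fin 3)) 1) \ S)) :
    ∃ R₀ > (0 : ℝ), ∀ R ≥ R₀,
      {t : ℝ | 0 ≤ t ∧ R ≤ ‖X t‖}.Nonempty ∧
      (X (sInf {t : ℝ | 0 ≤ t ∧ R ≤ ‖X t‖}) ∈ (fun ω => R • ω) '' S ↔
        ‖v‖⁻¹ • v ∈ S) := by
  have hlim := tendsto_inv_smul_of_norm_sub_le_sqrt hbound
  have hu : ‖v‖⁻¹ • v ∈ Metric.sphere (0 : EuclideanSpace ℝ (Fin 3)) 1 := by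
    simp [norm_smul, hv]
  obtain ⟨M, hM⟩ := eventually_atTop.1 ((tendsto_normalize_of_tendsto_inv_smul hv hlim).eventually
    (eventually_mem_iff_of_notMem_relative_frontier hu hvfr))
  obtain ⟨B, hB⟩ := (isCompact_Icc (a := (0 : ℝ)) (b := max M 0)).exists_bound_of_continuousOn
    (hXcont.mono Set.Icc_subset_Ici_self)
  have hB0 : ‖X 0‖ ≤ B := hB 0 ⟨le_rfl, le_max_right _ _⟩
  have hBnonneg : 0 ≤ B := (norm_nonneg _).trans hB0
  refine ⟨B + 1, by linarith, fun R hR => ?_⟩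
  have hRpos : 0 < R := by linarith
  have hne : {t : ℝ | 0 ≤ t ∧ R ≤ ‖X t‖}.Nonempty :=
    ((eventually_ge_atTop 0).and ((tendsto_norm_atTop_of_tendsto_inv_smul hv
      hlim).eventually_ge_atTop R)).exists
  refine ⟨hne, ?_⟩
  have hT := isLeast_firstExit hXcont hne
  generalize sInf {t : ℝ | 0 ≤ t ∧ R ≤ ‖X t‖} = T at hT
  have hTR : ‖X T‖ = R := norm_eq_of_isLeast_exit hXcont (by linarith) hT
  have hMT : M ≤ T := by
    by_contra! hlt
    have := hB T ⟨hT.1.1, hlt.le.trans (le_max_left _ _)⟩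
    linarith
  have hmem := hM T hMT
  rw [hTR] at hmem
  rw [Set.image_smul, Set.mem_smul_set_iff_inv_smul_mem₀ hRpos.ne']
  apply hmem
  rw [mem_sphere_zero_iff_norm, norm_smul, norm_inv, hTR, Real.norm_of_nonneg hRpos.le,
    inv_mul_cancel₀ hRpos.ne']
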